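/- Let phi : X1 -> X1 be convex. Then for every u in X1+ with u not equal to 0 there exists beta*_u in X1+ minus {0} such that |phi(x1) - phi(x2)| <= beta*_u . |x1 - x2| for all x1, x2 in the order interval [-u, u] = {v in X1 : -u <= v <= u}. -/

import Mathlib

/-- Convexity of a function `φ : X1 → X1` on a Dedekind complete vector lattice
endowed with a product `pr` (Definition 4.4 of the paper): there is a family of
"subgradients" `β v` with `φ s ≥ φ v + β v ⬝ (s - v)` for all `s`, and for every
`u ∈ X1⁺ \\ {0}` the set `{β v : v ∈ [-u, u]}` is order bounded in `X1`. -/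
def ConvexFn {X1 : Type*} [ConditionallyCompleteLattice X1] [AddCommGroup X1]
    (pr : X1 → X1 → X1) (φ : X1 → X1) : Prop :=
  ∃ β : X1 → X1,
    (∀ v s : X1, φ v + pr (β v) (s - v) ≤ φ s) ∧
    ∀ u : X1, 0 ≤ u → u ≠ 0 →
      ∃ a b : X1, ∀ v : X1, -u ≤ v → v ≤ u → a ≤ β v ∧ β v ≤ b

/-- A biadditive product that is monotone in its left argument against positive elements satisfies
`b ⬝ d ≤ B ⬝ |d|` whenever `|b| ≤ B`. -/
theorem pr_le_pr_abs {X : Type*} [Lattice X] [AddCommGroup X] [AddLeftMono X]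
    (pr : X → X → X)
    (hadd_left : ∀ x y z : X, pr (x + y) z = pr x z + pr y z)
    (hadd_right : ∀ x y z : X, pr x (y + z) = pr x y + pr x z)
    (hmono_left : ∀ x y z : X, y ≤ x → 0 ≤ z → pr y z ≤ pr x z)
    {b B : X} (hb : |b| ≤ B) (d : X) : pr b d ≤ pr B |d| := by
  have hpos : pr b d⁺ ≤ pr B d⁺ :=
    hmono_left _ _ _ ((le_abs_self b).trans hb) (posPart_nonneg d)
  have hneg : 0 ≤ pr B d⁻ + pr b d⁻ := by
    have hzero : pr 0 d⁻ = 0 := by simpa using hadd_left 0 0 d⁻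
    rw [← hadd_left, ← hzero]
    exact hmono_left _ _ _ (neg_le_iff_add_nonneg'.mp (neg_le.mp ((neg_le_abs b).trans hb)))
      (negPart_nonneg d)
  have hsplit : pr b d + pr b d⁻ = pr b d⁺ := by
    rw [← hadd_right]
    congr 1
    exact (sub_eq_iff_eq_add.mp (posPart_sub_negPart d)).symm
  rw [← posPart_add_negPart d, hadd_right]
  calc pr b d ≤ pr b d + (pr B d⁻ + pr b d⁻) := le_add_of_nonneg_right hneg
    _ = pr b d⁺ + pr B d⁻ := by rw [← hsplit]; abel
    _ ≤ pr B d⁺ + pr B d⁻ := add_le_add_left hpos _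

/-- Proposition 4.8 of the paper: a convex function `φ` is
"Lipschitz" on every order interval `[-u, u]`: there is
`β*_u ∈ X1⁺ \\ {0}` with `|φ x₁ - φ x₂| ≤ β*_u ⬝ |x₁ - x₂|` on `[-u, u]`. -/
theorem statement_12 {X1 : Type*}
    [ConditionallyCompleteLattice X1] [AddCommGroup X1] [Module ℝ X1]
    [CovariantClass X1 X1 (· + ·) (· ≤ ·)] [PosSMulMono ℝ X1]
    (pr : X1 → X1 → X1)
    (hadd_left : ∀ x y z : X1, pr (x + y) z = pr x z + pr y z)
    (hadd_right : ∀ x y z : X1, pr x (y + z) = pr x y + pr x z)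
    (hmono_left : ∀ x y z : X1, y ≤ x → 0 ≤ z → pr y z ≤ pr x z)
    (hmono_right : ∀ x y z : X1, 0 ≤ x → z ≤ y → pr x z ≤ pr x y)
    (φ : X1 → X1) (hconv : ConvexFn pr φ)
    (u : X1) (hu : 0 ≤ u) (hune : u ≠ 0) :
    ∃ βu : X1, 0 ≤ βu ∧ βu ≠ 0 ∧
      ∀ x1 x2 : X1, -u ≤ x1 → x1 ≤ u → -u ≤ x2 → x2 ≤ u →
        |φ x1 - φ x2| ≤ pr βu |x1 - x2| := by
  obtain ⟨β, hβ, hbdd⟩ := hconv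
  obtain ⟨a, b, hab⟩ := hbdd u hu hune
  have hnonneg : 0 ≤ |a| + |b| := add_nonneg (abs_nonneg a) (abs_nonneg b)
  have hle : u ≤ |a| + |b| + u := le_add_of_nonneg_left hnonneg
  have hβ_abs : ∀ v, -u ≤ v → v ≤ u → |β v| ≤ |a| + |b| + u := fun v h₁ h₂ => by
    obtain ⟨ha, hb⟩ := hab v h₁ h₂
    refine le_trans ?_ (le_add_of_nonneg_right hu)
    refine abs_le'.mpr ⟨?_, ?_⟩
    · exact (hb.trans (le_abs_self b)).trans (le_add_of_nonneg_left (abs_nonneg a))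
    · exact ((neg_le_neg_iff.mpr ha).trans (neg_le_abs a)).trans
        (le_add_of_nonneg_right (abs_nonneg b))
  have hsub : ∀ x y, -u ≤ x → x ≤ u → φ x - φ y ≤ pr (|a| + |b| + u) |x - y| := by
    intro x y h₁ h₂
    have hneg : pr (β x) (y - x) = -pr (β x) (x - y) := by
      have hzero : pr (β x) 0 = 0 := by simpa using hadd_right (β x) 0 0
      rw [eq_neg_iff_add_eq_zero, ← hadd_right, sub_add_sub_cancel, sub_self, hzero]
    have hsubgrad := hβ x y
    rw [hneg, ← sub_eq_add_neg, sub_le_comm] at hsubgrad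
    exact hsubgrad.trans
      (pr_le_pr_abs pr hadd_left hadd_right hmono_left (hβ_abs x h₁ h₂) (x - y))
  refine ⟨|a| + |b| + u, hu.trans hle, fun h => hune (le_antisymm (h ▸ hle) hu), ?_⟩
  intro x y hx₁ hx₂ hy₁ hy₂
  refine abs_le'.mpr ⟨hsub x y hx₁ hx₂, ?_⟩
  rw [neg_sub, abs_sub_comm]
  exact hsub y x hy₁ hy₂
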